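/- For every digraph D there exists an undirected simple graph G such that D contains the biorientation of G as a strong minor and the dichromatic number of D is at most twice the chromatic number of G. -/

import Mathlib

/-- Strong connectivity of the subdigraph induced on `S` by the digraph with arc relation `A`:
every ordered pair of vertices of `S` is joined by a directed path inside `S`. -/
def SConnOn {V : Type*} (A : V → V → Prop) (S : Set V) : Prop :=
  ∀ u ∈ S, ∀ v ∈ S, Relation.ReflTransGen (fun x y => x ∈ S ∧ y ∈ S ∧ A x y) u v

/-- The subdigraph induced on `S` contains no directed cycle. -/
def AcyclicOn {V : Type*} (A : V → V → Prop) (S : Set V) : Prop :=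
  ¬ ∃ u v, u ∈ S ∧ v ∈ S ∧ A u v ∧
      Relation.ReflTransGen (fun x y => x ∈ S ∧ y ∈ S ∧ A x y) v u

/-- The induced subdigraph on `S` admits an acyclic `k`-coloring. -/
def DiColorableOn {V : Type*} (A : V → V → Prop) (S : Set V) (k : ℕ) : Prop :=
  ∃ f : V → Fin k, ∀ c : Fin k, AcyclicOn A (S ∩ {v | f v = c})

/-- The digraph `(V, A)` admits an acyclic `k`-coloring. -/
def DiColorable {V : Type*} (A : V → V → Prop) (k : ℕ) : Prop :=
  DiColorableOn A Set.univ k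

/-- The dichromatic number of the digraph `(V, A)`, as an extended natural number. -/
noncomputable def diChromaticNumber {V : Type*} (A : V → V → Prop) : ℕ∞ :=
  sInf {n : ℕ∞ | ∃ k : ℕ, n = (k : ℕ∞) ∧ DiColorable A k}

/-- The digraph `(V, A)` contains the digraph `(W, B)` as a strong minor: a subdigraph of it
is a strong `(W, B)`-minor model, i.e. there are pairwise disjoint nonempty branch sets,
each inducing a strongly connected subdigraph, with an arc from `X w₁` to `X w₂`
for every arc `(w₁, w₂)` of `B`. -/
def IsStrongMinor {V W : Type*} (A : V → V → Prop) (B : W → W → Prop) : Prop :=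
  ∃ X : W → Set V,
    (∀ w, (X w).Nonempty) ∧
    (∀ w₁ w₂, w₁ ≠ w₂ → Disjoint (X w₁) (X w₂)) ∧
    (∀ w, SConnOn A (X w)) ∧
    (∀ w₁ w₂, B w₁ w₂ → ∃ x ∈ X w₁, ∃ y ∈ X w₂, A x y)

universe u

def Stp {V : Type*} (A : V → V → Prop) (S : Set V) : V → V → Prop :=
  fun x y => x ∈ S ∧ y ∈ S ∧ A x y

theorem stp_mono {V : Type*} {A : V → V → Prop} {S T : Set V} (h : S ⊆ T) {x y : V}
    (hr : Relation.ReflTransGen (Stp A S) x y) : Relation.ReflTransGen (Stp A T) x y :=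
  Relation.ReflTransGen.mono (r := Stp A S) (p := Stp A T)
    (fun _ _ hs => ⟨h hs.1, h hs.2.1, hs.2.2⟩) _ _ hr

theorem acyclicOn_mono {V : Type*} {A : V → V → Prop} {S T : Set V} (h : S ⊆ T)
    (hT : AcyclicOn A T) : AcyclicOn A S := by
  rintro ⟨u, v, hu, hv, ha, hr⟩
  exact hT ⟨u, v, h hu, h hv, ha, stp_mono h hr⟩

theorem acyclicOn_of_rank {V : Type*} {A : V → V → Prop} {S P : Set V} (ρ : V → ℕ)
    (h : ∀ x ∈ S, ∀ y ∈ S, A x y → ρ y < ρ x ∨ (x ∈ P ∧ y ∈ P ∧ ρ y = ρ x))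
    (hP : AcyclicOn A P) : AcyclicOn A S := by
  rintro ⟨u, v, hu, hv, ha, hr⟩
  have key : ∀ w, Relation.ReflTransGen (Stp A S) v w →
      ρ w < ρ v ∨ (ρ w = ρ v ∧ Relation.ReflTransGen (Stp A P) v w) := by
    intro w hw
    induction hw with
    | refl => exact Or.inr ⟨rfl, .refl⟩
    | tail _ hs ih =>
      obtain ⟨h1, h2, h3⟩ := hs
      rcases h _ h1 _ h2 h3 with h4 | ⟨h4, h5, h6⟩
      · rcases ih with ih | ih
        · left; omega
        · left; omega
      · rcases ih with ih | ih
        · left; omega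
        · exact Or.inr ⟨by omega, ih.2.tail ⟨h4, h5, h3⟩⟩
  rcases h u hu v hv ha with h1 | ⟨h1, h2, h3⟩
  · rcases key u hr with h4 | h4 <;> omega
  · rcases key u hr with h4 | h4
    · omega
    · exact hP ⟨u, v, h1, h2, ha, h4.2⟩

def PreEar {V : Type*} (A : V → V → Prop) (X T : Set V) (l : ℕ) (p : ℕ → V) : Prop :=
  (∀ i ≤ l, p i ∈ T ∧ p i ∉ X) ∧ (∀ i < l, A (p i) (p (i+1))) ∧ (∃ a ∈ X, A a (p 0))

def HasEar {V : Type*} (A : V → V → Prop) (X T : Set V) (l : ℕ) : Prop :=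
  ∃ p : ℕ → V, PreEar A X T l p ∧ ∃ d ∈ X, A (p l) d

/-- a cycle either stays inside `X` or gives an ear -/
theorem cycle_ear {V : Type*} {A : V → V → Prop} {X T : Set V} {u : V} (hu : u ∈ X)
    {y : V} (hr : Relation.TransGen (Stp A T) u y) :
    (∃ l, HasEar A X T l) ∨ (y ∈ X ∧ Relation.TransGen (Stp A (X ∩ T)) u y) ∨
      (y ∉ X ∧ ∃ l p, PreEar A X T l p ∧ p l = y) := by
  induction hr with
  | @single y hs =>
    obtain ⟨h1, h2, h3⟩ := hs
    by_cases hy : y ∈ X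
    · exact Or.inr (Or.inl ⟨hy, .single ⟨⟨hu, h1⟩, ⟨hy, h2⟩, h3⟩⟩)
    · exact Or.inr (Or.inr ⟨hy, 0, fun _ => y, ⟨fun _ _ => ⟨h2, hy⟩, by simp, u, hu, h3⟩, rfl⟩)
  | @tail x y _ hs ih =>
    obtain ⟨h1, h2, h3⟩ := hs
    rcases ih with ih | ⟨hx, ih⟩ | ⟨hx, l, p, ⟨hp1, hp2, hp3⟩, hpl⟩
    · exact Or.inl ih
    · by_cases hy : y ∈ X
      · exact Or.inr (Or.inl ⟨hy, ih.tail ⟨⟨hx, h1⟩, ⟨hy, h2⟩, h3⟩⟩)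
      · exact Or.inr (Or.inr ⟨hy, 0, fun _ => y, ⟨fun _ _ => ⟨h2, hy⟩, by simp, x, hx, h3⟩, rfl⟩)
    · by_cases hy : y ∈ X
      · exact Or.inl ⟨l, p, ⟨hp1, hp2, hp3⟩, y, hy, hpl ▸ h3⟩
      · refine Or.inr (Or.inr ⟨hy, l+1, fun i => if i ≤ l then p i else y, ⟨?_, ?_, ?_⟩, by simp⟩)
        · intro i _
          by_cases hil : i ≤ l
          · simpa [hil] using hp1 i hil
          · simpa [hil] using ⟨h2, hy⟩
        · intro i hi
          rcases Nat.lt_or_ge i l with hil | hil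
          · have a1 : i ≤ l := by omega
            have a2 : i + 1 ≤ l := by omega
            simpa [a1, a2] using hp2 i hil
          · have : i = l := by omega
            subst this
            simpa [hpl] using h3
        · simpa using hp3

/-- the data of a strongly connected set, coloured by two acyclic sets -/
def GoodPair {V : Type*} (A : V → V → Prop) (R : Set V) (z : Set V × Set V) : Prop :=
  z.1 ∪ z.2 ⊆ R ∧ SConnOn A (z.1 ∪ z.2) ∧ AcyclicOn A z.1 ∧ AcyclicOn A z.2

theorem exists_maximal_pair {V : Type*} (A : V → V → Prop) (hl : ∀ v, ¬ A v v) (R : Set V)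
    (v : V) (hv : v ∈ R) :
    ∃ z, v ∈ z.1 ∪ z.2 ∧ Maximal (fun z => z ∈ {z | GoodPair A R z}) z := by
  have := zorn_le_nonempty₀ {z | GoodPair A R z} ?_ (({v} : Set V), (∅ : Set V)) ?_
  · obtain ⟨m, hm, hmax⟩ := this
    exact ⟨m, Or.inl (hm.1 rfl), hmax⟩
  · intro c hc hch y hy
    have path : ∀ g : Set V × Set V → Set V, Monotone g → ∀ a b,
        Relation.ReflTransGen (Stp A (⋃ z ∈ c, g z)) a b → ∀ z0 ∈ c, ∃ z ∈ c, z0 ≤ z ∧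
          Relation.ReflTransGen (Stp A (g z)) a b := by
      intro g hg a b hr z0 hz0
      induction hr with
      | refl => exact ⟨z0, hz0, le_rfl, .refl⟩
      | tail _ hs ih =>
        obtain ⟨h1, h2, h3⟩ := hs
        obtain ⟨z, hz, hzz, hr⟩ := ih
        simp only [Set.mem_iUnion] at h1 h2
        obtain ⟨z1, hz1, h1⟩ := h1
        obtain ⟨z2, hz2, h2⟩ := h2
        obtain ⟨z3, hz3, a1, a2⟩ := hch.directedOn z hz z1 hz1
        obtain ⟨z4, hz4, b1, b2⟩ := hch.directedOn z3 hz3 z2 hz2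
        exact ⟨z4, hz4, hzz.trans (a1.trans b1),
          (stp_mono (hg (a1.trans b1)) hr).tail ⟨hg (a2.trans b1) h1, hg b2 h2, h3⟩⟩
    have acyc : ∀ g : Set V × Set V → Set V, Monotone g → (∀ z ∈ c, AcyclicOn A (g z)) →
        AcyclicOn A (⋃ z ∈ c, g z) := by
      rintro g hg hgc ⟨a, b, ha, hb, hab, hr⟩
      simp only [Set.mem_iUnion] at ha hb
      obtain ⟨z1, hz1, h1⟩ := ha
      obtain ⟨z2, hz2, h2⟩ := hb
      obtain ⟨z3, hz3, a1, a2⟩ := hch.directedOn z1 hz1 z2 hz2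
      obtain ⟨z, hz, hzz, hr⟩ := path g hg _ _ hr z3 hz3
      exact hgc z hz ⟨a, b, hg (a1.trans hzz) h1, hg (a2.trans hzz) h2, hab, hr⟩
    have hmu : Monotone (fun z : Set V × Set V => z.1 ∪ z.2) :=
      fun a b h => Set.union_subset_union h.1 h.2
    have hU : (⋃ z ∈ c, z.1) ∪ (⋃ z ∈ c, z.2) = ⋃ z ∈ c, (z.1 ∪ z.2) := by
      simp only [Set.iUnion_union_distrib]
    refine ⟨(⋃ z ∈ c, z.1, ⋃ z ∈ c, z.2), ⟨?_, ?_, ?_, ?_⟩, ?_⟩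
    · simp only [hU]
      exact Set.iUnion₂_subset fun z hz => (hc hz).1
    · simp only [hU]
      intro a ha b hb
      simp only [Set.mem_iUnion] at ha hb
      obtain ⟨z1, hz1, h1⟩ := ha
      obtain ⟨z2, hz2, h2⟩ := hb
      obtain ⟨z3, hz3, a1, a2⟩ := hch.directedOn z1 hz1 z2 hz2
      exact stp_mono (Set.subset_biUnion_of_mem (u := fun z : Set V × Set V => z.1 ∪ z.2) hz3)
        ((hc hz3).2.1 a (hmu a1 h1) b (hmu a2 h2))
    · exact acyc _ (fun a b h => h.1) fun z hz => (hc hz).2.2.1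
    · exact acyc _ (fun a b h => h.2) fun z hz => (hc hz).2.2.2
    · intro z hz
      exact ⟨Set.subset_biUnion_of_mem (u := fun z : Set V × Set V => z.1) hz,
        Set.subset_biUnion_of_mem (u := fun z : Set V × Set V => z.2) hz⟩
  · refine ⟨by simpa using hv, ?_, ?_, ?_⟩
    · rintro a ha b hb
      simp at ha hb
      subst ha; subst hb
      exact .refl
    · rintro ⟨a, b, ha, hb, hab, -⟩
      simp at ha hb
      subst ha; subst hb
      exact hl _ hab
    · rintro ⟨a, b, ha, -⟩
      exact ha

theorem maximal_ear {V : Type*} (A : V → V → Prop) (hl : ∀ v, ¬ A v v) (R : Set V)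
    (z : Set V × Set V) (hz : Maximal (fun z => z ∈ {z | GoodPair A R z}) z)
    (T : Set V) (hT : T ⊆ R) (hear : ∃ l, HasEar A (z.1 ∪ z.2) T l) :
    ∃ y ∈ T, y ∉ z.1 ∪ z.2 ∧ (∃ a ∈ z.1 ∪ z.2, A a y) ∧ (∃ d ∈ z.1 ∪ z.2, A y d) := by
  classical
  obtain ⟨P, Q⟩ := z
  simp only at *
  set X := P ∪ Q with hX
  have hmin : ∀ m, HasEar A X T m → Nat.find hear ≤ m := fun m hm => Nat.find_min' hear hm
  obtain ⟨p, ⟨hp1, hp2, a, ha, hap⟩, d, hd, hpd⟩ := Nat.find_spec hear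
  generalize Nat.find hear = l at *
  rcases Nat.eq_zero_or_pos l with h0 | hpos
  · subst h0
    exact ⟨p 0, (hp1 0 le_rfl).1, (hp1 0 le_rfl).2, ⟨a, ha, hap⟩, d, hd, hpd⟩
  exfalso
  have f1 : ∀ i ≤ l, ∀ x ∈ X, A x (p i) → i = 0 := by
    intro i hi x hx hxi
    have := hmin (l - i) ⟨fun k => p (i + k), ⟨fun k hk => hp1 _ (by omega),
      fun k hk => hp2 (i + k) (by omega), x, hx, hxi⟩, d, hd, by
        simpa [show i + (l - i) = l by omega] using hpd⟩
    omega
  have f2 : ∀ i ≤ l, ∀ x ∈ X, A (p i) x → i = l := by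
    intro i hi x hx hxi
    have := hmin i ⟨p, ⟨fun k hk => hp1 _ (by omega),
      fun k hk => hp2 k (by omega), a, ha, hap⟩, x, hx, hxi⟩
    omega
  have f3 : ∀ i ≤ l, ∀ j ≤ l, A (p i) (p j) → j ≤ i + 1 := by
    intro i hi j hj hij
    by_contra hcon
    have := hmin (l - (j - i - 1)) ⟨fun k => if k ≤ i then p k else p (k + (j - i - 1)),
      ⟨?_, ?_, a, ha, by simpa using hap⟩, d, hd, ?_⟩
    · omega
    · intro k hk
      by_cases hki : k ≤ i
      · simpa [hki] using hp1 k (by omega)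
      · simpa [hki] using hp1 (k + (j - i - 1)) (by omega)
    · intro k hk
      rcases lt_trichotomy k i with h | h | h
      · have h1 : k ≤ i := by omega
        have h2 : k + 1 ≤ i := by omega
        simpa [h1, h2] using hp2 k (by omega)
      · subst h
        have h2 : k + 1 + (j - k - 1) = j := by omega
        simpa [h2] using hij
      · have h1 : ¬ k ≤ i := by omega
        have h2 : ¬ k + 1 ≤ i := by omega
        have h3 : k + 1 + (j - i - 1) = k + (j - i - 1) + 1 := by omega
        simp only [h1, h2, h3, if_false]
        exact hp2 _ (by omega)
    · have h1 : ¬ l - (j - i - 1) ≤ i := by omega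
      have h2 : l - (j - i - 1) + (j - i - 1) = l := by omega
      simpa only [h1, h2, if_false] using hpd
  have inj' : ∀ i j, i ≤ l → j ≤ l → i < j → p i ≠ p j := by
    intro i j hi hj hij h
    rcases Nat.lt_or_ge j l with hjl | hjl
    · have := f3 i hi (j+1) (by omega) (h ▸ hp2 j hjl)
      omega
    · have : j = l := by omega
      subst this
      have := f2 i hi d hd (h ▸ hpd)
      omega
  have inj : ∀ i j, i ≤ l → j ≤ l → p i = p j → i = j := by
    intro i j hi hj h
    rcases lt_trichotomy i j with h1 | h1 | h1
    · exact absurd h (inj' i j hi hj h1)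
    · exact h1
    · exact absurd h.symm (inj' j i hj hi h1)
  -- rank function
  obtain ⟨ρ, hρX, hρp⟩ : ∃ ρ : V → ℕ, (∀ x ∈ X, ρ x = 1) ∧
      (∀ i ≤ l, ρ (p i) = if i = 0 then 0 else i + 1) := by
    refine ⟨fun x => if x ∈ X then 1 else
      if h : ∃ i, i ≤ l ∧ p i = x then (if h.choose = 0 then 0 else h.choose + 1) else 0, ?_, ?_⟩
    · intro x hx; simp [hx]
    · intro i hi
      have hex : ∃ j, j ≤ l ∧ p j = p i := ⟨i, hi, rfl⟩
      have hc : hex.choose = i := inj _ _ hex.choose_spec.1 hi hex.choose_spec.2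
      simp only [(hp1 i hi).2, if_false, hex, dif_pos, hc]
  have acyc : ∀ (I : ℕ → Prop), (∀ i, I i → ¬ I (i+1)) → ∀ Y ⊆ X, AcyclicOn A Y →
      AcyclicOn A (Y ∪ {x | ∃ i ≤ l, I i ∧ p i = x}) := by
    intro I hI Y hY hYa
    refine acyclicOn_of_rank ρ ?_ hYa
    rintro x (hx | ⟨i, hi, hIi, rfl⟩) y (hy | ⟨j, hj, hIj, rfl⟩) hxy
    · exact Or.inr ⟨hx, hy, by rw [hρX _ (hY hx), hρX _ (hY hy)]⟩
    · left
      have := f1 j hj x (hY hx) hxy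
      rw [hρX _ (hY hx), hρp _ hj]; simp [this]
    · left
      have := f2 i hi y (hY hy) hxy
      rw [hρX _ (hY hy), hρp _ hi, if_neg (by omega)]; omega
    · left
      have h1 := f3 i hi j hj hxy
      have h2 : j ≠ i + 1 := by rintro rfl; exact hI i hIi hIj
      have h3 : j ≠ i := by rintro rfl; exact hl _ hxy
      rw [hρp _ hi, hρp _ hj]
      split_ifs <;> omega
  set P' := P ∪ {x | ∃ i ≤ l, Even i ∧ p i = x} with hP'
  set Q' := Q ∪ {x | ∃ i ≤ l, ¬ Even i ∧ p i = x} with hQ'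
  have hXs : X ⊆ P' ∪ Q' := by
    rintro x (h | h)
    · exact Or.inl (Or.inl h)
    · exact Or.inr (Or.inl h)
  have hps : ∀ i ≤ l, p i ∈ P' ∪ Q' := by
    intro i hi
    by_cases h : Even i
    · exact Or.inl (Or.inr ⟨i, hi, h, rfl⟩)
    · exact Or.inr (Or.inr ⟨i, hi, h, rfl⟩)
  have hcases : ∀ x ∈ P' ∪ Q', x ∈ X ∨ ∃ i ≤ l, p i = x := by
    rintro x ((h | ⟨i, hi, -, h⟩) | (h | ⟨i, hi, -, h⟩))
    · exact Or.inl (Or.inl h)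
    · exact Or.inr ⟨i, hi, h⟩
    · exact Or.inl (Or.inr h)
    · exact Or.inr ⟨i, hi, h⟩
  obtain ⟨g1, g2, g3, g4⟩ := hz.1
  have from_a : ∀ i ≤ l, Relation.ReflTransGen (Stp A (P' ∪ Q')) a (p i) := by
    intro i
    induction i with
    | zero => intro hi; exact .single ⟨hXs ha, hps 0 hi, hap⟩
    | succ k ih => intro hi; exact (ih (by omega)).tail ⟨hps k (by omega), hps _ hi, hp2 k (by omega)⟩
  have to_d : ∀ k, ∀ i, i + k = l → Relation.ReflTransGen (Stp A (P' ∪ Q')) (p i) d := by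
    intro k
    induction k with
    | zero =>
      intro i hi
      have : i = l := by omega
      subst this
      exact .single ⟨hps i le_rfl, hXs hd, hpd⟩
    | succ k ih =>
      intro i hi
      exact (ih (i+1) (by omega)).head ⟨hps i (by omega), hps _ (by omega), hp2 i (by omega)⟩
  have into : ∀ x ∈ P' ∪ Q', Relation.ReflTransGen (Stp A (P' ∪ Q')) a x := by
    intro x hx
    rcases hcases x hx with h | ⟨i, hi, rfl⟩
    · exact stp_mono hXs (g2 a ha x h)
    · exact from_a i hi
  have outof : ∀ x ∈ P' ∪ Q', Relation.ReflTransGen (Stp A (P' ∪ Q')) x a := by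
    intro x hx
    rcases hcases x hx with h | ⟨i, hi, rfl⟩
    · exact stp_mono hXs (g2 x h a ha)
    · exact (to_d (l - i) i (by omega)).trans (stp_mono hXs (g2 d hd a ha))
  have hgood : GoodPair A R (P', Q') := by
    refine ⟨?_, ?_, ?_, ?_⟩
    · intro x hx
      rcases hcases x hx with h | ⟨i, hi, rfl⟩
      · exact g1 h
      · exact hT (hp1 i hi).1
    · intro x hx y hy
      exact (outof x hx).trans (into y hy)
    · exact acyc _ (by intro i h; simpa [Nat.even_add_one] using h) P Set.subset_union_left g3
    · exact acyc _ (by intro i h; simpa [Nat.even_add_one] using h) Q Set.subset_union_right g4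
  have := hz.2 hgood ⟨Set.subset_union_left, Set.subset_union_left⟩
  apply (hp1 0 (by omega)).2
  exact Or.inl (this.1 (Or.inr ⟨0, by omega, by simp, rfl⟩))

/-- transfinite greedy decomposition -/
theorem exists_decomp {V : Type*} (A : V → V → Prop) (hl : ∀ v, ¬ A v v) :
    ∃ (lt : V → V → Prop) (_ : IsWellOrder V lt) (Z : V → Set V × Set V) (R : V → Set V),
      (∀ v, R v = {x | ∀ w, lt w v → x ∉ (Z w).1 ∪ (Z w).2}) ∧
      (∀ v, v ∈ R v → v ∈ (Z v).1 ∪ (Z v).2 ∧ Maximal (fun z => z ∈ {z | GoodPair A (R v) z}) (Z v)) ∧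
      (∀ v, v ∉ R v → Z v = (∅, ∅)) := by
  classical
  choose! M hM1 hM2 using exists_maximal_pair A hl
  have wf : WellFounded (WellOrderingRel (α := V)) := IsWellFounded.wf
  let F : (v : V) → ((w : V) → WellOrderingRel w v → Set V × Set V) → Set V × Set V :=
    fun v ih => if v ∈ {x | ∀ w (h : WellOrderingRel w v), x ∉ (ih w h).1 ∪ (ih w h).2} then
      M {x | ∀ w (h : WellOrderingRel w v), x ∉ (ih w h).1 ∪ (ih w h).2} v else (∅, ∅)
  let Z := wf.fix F
  let R : V → Set V := fun v => {x | ∀ w, WellOrderingRel w v → x ∉ (Z w).1 ∪ (Z w).2}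
  have hZ : ∀ v, Z v = if v ∈ R v then M (R v) v else (∅, ∅) := fun v => wf.fix_eq F v
  refine ⟨WellOrderingRel, inferInstance, Z, R, fun v => rfl, ?_, ?_⟩
  · intro v hv
    rw [hZ v, if_pos hv]
    exact ⟨hM1 _ _ hv, hM2 _ _ hv⟩
  · intro v hv
    rw [hZ v, if_neg hv]

/-- For every (loopless) digraph `D` there is an undirected simple graph `G`
such that `D` contains the biorientation of `G` as a strong minor and the dichromatic number
of `D` is at most twice the chromatic number of `G`. -/
theorem exists_graph_strongMinor_dichromatic_le {V : Type u} (A : V → V → Prop)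
    (hloopless : ∀ v, ¬ A v v) :
    ∃ (W : Type u) (G : SimpleGraph W),
      IsStrongMinor A (fun u v => G.Adj u v) ∧
      diChromaticNumber A ≤ 2 * G.chromaticNumber := by
  classical
  obtain ⟨lt, hwo, Z, R, hR, hZ1, hZ2⟩ := exists_decomp A hloopless
  have wf : WellFounded lt := IsWellFounded.wf
  let X : V → Set V := fun v => (Z v).1 ∪ (Z v).2
  have hXR : ∀ v, v ∈ R v → X v ⊆ R v := fun v hv => (hZ1 v hv).2.1.1
  have hdis' : ∀ v w, v ∈ R v → lt w v → Disjoint (X w) (X v) := by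
    intro v w hv hwv
    rw [Set.disjoint_left]
    intro x hx hx'
    have := hXR v hv hx'
    rw [hR] at this
    exact this w hwv hx
  have hcov : ∀ x, ∃ w : {v // v ∈ R v}, x ∈ X w := by
    intro x
    by_cases hx : x ∈ R x
    · exact ⟨⟨x, hx⟩, (hZ1 x hx).1⟩
    · have h2 := hx
      rw [hR] at h2
      simp only [Set.mem_ofPred_eq, not_forall, not_not] at h2
      obtain ⟨w, -, hw⟩ := h2
      by_cases hww : w ∈ R w
      · exact ⟨⟨w, hww⟩, hw⟩
      · rw [hZ2 w hww] at hw
        simp at hw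
  choose idx hidx using hcov
  let G : SimpleGraph {v // v ∈ R v} :=
    { Adj := fun a b => a ≠ b ∧ (∃ x ∈ X a, ∃ y ∈ X b, A x y) ∧ (∃ x ∈ X b, ∃ y ∈ X a, A x y)
      symm := ⟨fun a b h => ⟨h.1.symm, h.2.2, h.2.1⟩⟩
      loopless := ⟨fun a h => h.1 rfl⟩ }
  refine ⟨{v // v ∈ R v}, G, ⟨fun w => X w, ?_, ?_, ?_, ?_⟩, ?_⟩
  · exact fun w => ⟨w, (hZ1 w w.2).1⟩
  · intro a b hab
    rcases trichotomous_of lt a.1 b.1 with h | h | h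
    · exact hdis' _ _ b.2 h
    · exact absurd (Subtype.ext h) hab
    · exact (hdis' _ _ a.2 h).symm
  · exact fun w => (hZ1 w w.2).2.1.2.1
  · exact fun a b h => h.2.1
  by_cases htop : G.chromaticNumber = ⊤
  · rw [htop]
    simp
  obtain ⟨n, hn⟩ := ENat.ne_top_iff_exists.1 htop
  have hcol : G.Colorable n := SimpleGraph.chromaticNumber_le_iff_colorable.1 hn.symm.le
  obtain ⟨col⟩ := hcol
  rw [← hn]
  refine sInf_le ⟨2 * n, by push_cast; rfl, ?_⟩
  refine ⟨fun v => finProdFinEquiv (if v ∈ (Z (idx v)).1 then (0 : Fin 2) else 1, col (idx v)), ?_⟩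
  intro c
  obtain ⟨⟨s, k⟩, rfl⟩ := finProdFinEquiv.surjective c
  set S : Set V := Set.univ ∩ {v | finProdFinEquiv (if v ∈ (Z (idx v)).1 then (0 : Fin 2) else 1,
    col (idx v)) = finProdFinEquiv (s, k)} with hS
  have hS' : ∀ x ∈ S, (if x ∈ (Z (idx x)).1 then (0 : Fin 2) else 1) = s ∧ col (idx x) = k := by
    intro x hx
    simpa [hS] using hx
  rintro ⟨u0, v0, hu0, hv0, ha0, hr0⟩
  have hne : Set.Nonempty {w : V | ∃ u, (idx u).1 = w ∧ Relation.TransGen (Stp A S) u u} :=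
    ⟨_, u0, rfl, Relation.TransGen.head' ⟨hu0, hv0, ha0⟩ hr0⟩
  obtain ⟨w, ⟨u, hu, huu⟩, hwmin⟩ := wf.has_min _ hne
  obtain ⟨w', hw'⟩ : ∃ w', w' = idx u := ⟨_, rfl⟩
  set T : Set V := {x | x ∈ S ∧ Relation.ReflTransGen (Stp A S) u x ∧
    Relation.ReflTransGen (Stp A S) x u} with hT
  have huS : u ∈ S := by
    obtain ⟨_, h, -⟩ := Relation.TransGen.head'_iff.1 huu
    exact h.1
  have hTR : T ⊆ R w := by
    rintro x ⟨hx, h1, h2⟩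
    have hxx : Relation.TransGen (Stp A S) x x :=
      Relation.TransGen.trans_right h2 (huu.trans_left h1)
    have hnl := hwmin _ ⟨x, rfl, hxx⟩
    rw [hR]
    intro w1 hw1 hx1
    have h3 : lt w1 (idx x).1 := by
      rcases trichotomous_of lt w (idx x).1 with h | h | h
      · exact _root_.trans hw1 h
      · rwa [← h]
      · exact absurd h hnl
    exact Set.disjoint_left.1 (hdis' _ _ (idx x).2 h3) hx1 (hidx x)
  have huT : Relation.TransGen (Stp A T) u u := by
    have key : ∀ y, Relation.TransGen (Stp A S) u y → Relation.ReflTransGen (Stp A S) y u →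
        Relation.TransGen (Stp A T) u y := by
      intro y hy
      induction hy with
      | single h =>
        intro h'
        exact .single ⟨⟨h.1, .refl, .head h h'⟩, ⟨h.2.1, .single h, h'⟩, h.2.2⟩
      | tail h1 h ih =>
        intro h'
        exact (ih (.head h h')).tail ⟨⟨h.1, h1.to_reflTransGen, .head h h'⟩,
          ⟨h.2.1, h1.to_reflTransGen.tail h, h'⟩, h.2.2⟩
    exact key u huu .refl
  have hwR : w ∈ R w := hu ▸ (idx u).2
  have huX : u ∈ X w := hu ▸ hidx u
  have huniq : ∀ x ∈ X w, (idx x).1 = w := by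
    intro x hx
    rcases trichotomous_of lt w (idx x).1 with h | h | h
    · exact absurd (hidx x) (Set.disjoint_left.1 (hdis' _ _ (idx x).2 h) hx)
    · exact h.symm
    · exact absurd hx (Set.disjoint_left.1 (hdis' _ _ hwR h) (hidx x))
  have hmax := (hZ1 w hwR).2
  rcases cycle_ear huX huT with hear | ⟨-, hcyc⟩ | ⟨h, -⟩
  · obtain ⟨y, hyT, hyX, ⟨a, ha, hay⟩, d, hd, hyd⟩ := maximal_ear A hloopless (R w) (Z w) hmax T hTR hear
    have hne : (idx u) ≠ (idx y) := by
      intro h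
      apply hyX
      have := hidx y
      rw [← h, hu] at this
      exact this
    have hadj : G.Adj (idx u) (idx y) :=
      ⟨hne, ⟨a, by rw [hu]; exact ha, y, hidx y, hay⟩, ⟨y, hidx y, d, by rw [hu]; exact hd, hyd⟩⟩
    exact col.valid hadj ((hS' u huS).2.trans (hS' y hyT.1).2.symm)
  · obtain ⟨b, hb1, hb2⟩ := Relation.TransGen.head'_iff.1 hcyc
    have hac : AcyclicOn A (X w ∩ T) := by
      by_cases hs : s = 0
      · refine acyclicOn_mono ?_ hmax.1.2.2.1
        rintro x ⟨hx, hxT⟩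
        have h1 := (hS' x hxT.1).1
        rw [huniq x hx, hs] at h1
        by_contra hcon
        simp [hcon] at h1
      · refine acyclicOn_mono ?_ hmax.1.2.2.2
        rintro x ⟨hx, hxT⟩
        have h1 := (hS' x hxT.1).1
        rw [huniq x hx] at h1
        rcases hx with hx | hx
        · rw [if_pos hx] at h1
          exact absurd h1.symm hs
        · exact hx
    exact hac ⟨u, b, hb1.1, hb1.2.1, hb1.2.2, hb2⟩
  · exact h huX
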